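/- The disjoint union of three copies of the double ray ℤ is (2ℤ, 2S_1)-minimal, where 2ℤ is the disjoint union of two double rays and 2S_1 is a matching of size two. In particular, the disjoint union of four copies of ℤ is not (2ℤ, 2S_1)-minimal, even though 2ℤ is (2ℤ, S_1)-minimal. -/

import Mathlib

open SimpleGraph

universe u v w x

/-- A monochromatic copy: `col = true` means red, `col = false` means blue.
There is a copy of `G` in `F` all of whose edges get color `col` under `c`. -/
def HasMonoCopy {α β : Type*} (F : SimpleGraph α) (c : Sym2 α → Bool) (col : Bool)
    (G : SimpleGraph β) : Prop :=
  ∃ f : β → α, Function.Injective f ∧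
    ∀ ⦃x y⦄, G.Adj x y → F.Adj (f x) (f y) ∧ c s(f x, f y) = col

/-- `F → (G,H)`: every red-blue edge coloring of `F` yields a red `G` or a blue `H`. -/
def Arrows {α β γ : Type*} (F : SimpleGraph α) (G : SimpleGraph β) (H : SimpleGraph γ) : Prop :=
  ∀ c : Sym2 α → Bool, HasMonoCopy F c true G ∨ HasMonoCopy F c false H

/-- A `(G,H)`-good coloring of `F`: neither a red copy of `G` nor a blue copy of `H`. -/
def GoodColoring {α β γ : Type*} (F : SimpleGraph α) (G : SimpleGraph β) (H : SimpleGraph γ)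
    (c : Sym2 α → Bool) : Prop :=
  ¬ HasMonoCopy F c true G ∧ ¬ HasMonoCopy F c false H

/-- `F` is `(G,H)`-minimal: `F → (G,H)` but no proper subgraph of `F` arrows `(G,H)`. -/
def IsRamseyMinimal {α β γ : Type*} (F : SimpleGraph α) (G : SimpleGraph β)
    (H : SimpleGraph γ) : Prop :=
  Arrows F G H ∧ ∀ F' : F.Subgraph, F' ≠ ⊤ → ¬ Arrows F'.coe G H

/-- `G` embeds into `H` (as a, not necessarily induced, subgraph). -/
def Embeds {α β : Type*} (G : SimpleGraph α) (H : SimpleGraph β) : Prop :=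
  ∃ f : α → β, Function.Injective f ∧ ∀ ⦃x y⦄, G.Adj x y → H.Adj (f x) (f y)

/-- `G` is self-embeddable: it is isomorphic to a proper subgraph of itself. -/
def SelfEmbeddable {α : Type*} (G : SimpleGraph α) : Prop :=
  ∃ G' : G.Subgraph, G' ≠ ⊤ ∧ Nonempty (G ≃g G'.coe)

/-- A graph is leafless if no vertex has exactly one neighbor. -/
def Leafless {α : Type*} (G : SimpleGraph α) : Prop :=
  ∀ v : α, ¬ ∃! w, G.Adj v w

/-- `G` is a star `K_{1,κ}` (κ ≥ 1): a center adjacent to every other vertex,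
every edge meets the center, and there is at least one other vertex. -/
def IsStar {α : Type*} (G : SimpleGraph α) : Prop :=
  ∃ c : α, (∃ v, v ≠ c) ∧ (∀ v, v ≠ c → G.Adj c v) ∧ ∀ ⦃x y⦄, G.Adj x y → x = c ∨ y = c

/-- A star forest: every connected component is a star. -/
def IsStarForest {α : Type*} (G : SimpleGraph α) : Prop :=
  ∀ C : G.ConnectedComponent, IsStar (G.induce C.supp)

/-- The star `S_n` with `n` edges: center `none`, leaves `some i`. -/
def starGraph (n : ℕ) : SimpleGraph (Option (Fin n)) :=
  SimpleGraph.fromRel fun a b => a = none ∨ b = none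

/-- Disjoint union of two graphs. -/
def sumGraph {α β : Type*} (G : SimpleGraph α) (H : SimpleGraph β) : SimpleGraph (α ⊕ β) :=
  SimpleGraph.fromRel fun a b =>
    match a, b with
    | Sum.inl a, Sum.inl b => G.Adj a b
    | Sum.inr a, Sum.inr b => H.Adj a b
    | _, _ => False

/-- Disjoint union of a family of graphs. -/
def sigmaGraph {ι : Type*} {V : ι → Type*} (G : ∀ i, SimpleGraph (V i)) :
    SimpleGraph (Σ i, V i) :=
  SimpleGraph.fromRel fun a b => ∃ h : a.1 = b.1, (G b.1).Adj (h ▸ a.2) b.2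

/-- The double ray (two-way infinite path). -/
def doubleRay : SimpleGraph ℤ := SimpleGraph.fromRel fun a b => b = a + 1

/-- The ray (one-way infinite path). -/
def rayGraph : SimpleGraph ℕ := SimpleGraph.fromRel fun a b => b = a + 1

/-- `2S_1`: a matching with two edges. -/
def twoS1 : SimpleGraph (Fin 2 ⊕ Fin 2) :=
  sumGraph (⊤ : SimpleGraph (Fin 2)) (⊤ : SimpleGraph (Fin 2))

/-- `kℤ`: the disjoint union of `k` double rays. -/
def nZ (k : ℕ) : SimpleGraph (Σ _ : Fin k, ℤ) :=
  sigmaGraph fun _ : Fin k => doubleRay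

/-- The 4-cycle. -/
def cycle4 : SimpleGraph (ZMod 4) := SimpleGraph.fromRel fun a b => b = a + 1

/-- The subdivision graph `S(G)`: each edge of `G` gets a new subdividing vertex. -/
def subdivision {α : Type*} (G : SimpleGraph α) : SimpleGraph (α ⊕ G.edgeSet) :=
  SimpleGraph.fromRel fun a b =>
    match a, b with
    | Sum.inl v, Sum.inr e => v ∈ (e : Sym2 α)
    | _, _ => False

/-- The graph `Γ(K,A,n)`: to each `u ∈ A` of (finite) degree `m` we add `m·(n-1)` new
clones of `u`, each joined to precisely the neighbors of `u` in `K`. -/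
def Gamma {α : Type*} (K : SimpleGraph α) (A : Set α) (n : ℕ) :
    SimpleGraph (α ⊕ Σ u : A, Fin ((K.neighborSet (u : α)).ncard * (n - 1))) :=
  SimpleGraph.fromRel fun a b =>
    match a, b with
    | Sum.inl x, Sum.inl y => K.Adj x y
    | Sum.inl x, Sum.inr p => K.Adj (p.1 : α) x
    | _, _ => False

/-- The extension property of the Rado graph. -/
def ExtensionProperty {α : Type*} (R : SimpleGraph α) : Prop :=
  ∀ U W : Finset α, Disjoint U W →
    ∃ v, v ∉ U ∧ v ∉ W ∧ (∀ u ∈ U, R.Adj v u) ∧ ∀ w ∈ W, ¬ R.Adj v w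

/-- The set of subdividing vertices of `S(G)`. -/
def subdividers {α : Type*} (G : SimpleGraph α) : Set (α ⊕ G.edgeSet) :=
  Set.range Sum.inr

/-- Vertex type of `Γ(S(G), A, m)` with `A` the subdividing vertices. -/
abbrev GammaVert {α : Type*} (G : SimpleGraph α) (m : ℕ) :=
  (α ⊕ G.edgeSet) ⊕
    Σ u : subdividers G, Fin (((subdivision G).neighborSet (u : α ⊕ G.edgeSet)).ncard * (m - 1))

/-- `Γ = ⋃_{i} Γ(S(G), A, n i)` with `A` the subdividing vertices of `S(G)`. -/
def bigGamma {α : Type*} (G : SimpleGraph α) {k : ℕ} (n : Fin k → ℕ) :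
    SimpleGraph (Σ i : Fin k, GammaVert G (n i)) :=
  sigmaGraph fun i => Gamma (subdivision G) (subdividers G) (n i)

/-- The set `A_{u,i}` inside `Γ`: the copy of `u` in `Γ_i` together with all its clones. -/
def cloneSet {α : Type*} (G : SimpleGraph α) {k : ℕ} (n : Fin k → ℕ)
    (u : subdividers G) (i : Fin k) : Set (Σ i : Fin k, GammaVert G (n i)) :=
  {p | p = ⟨i, Sum.inl (u : α ⊕ G.edgeSet)⟩ ∨
    ∃ j : Fin (((subdivision G).neighborSet (u : α ⊕ G.edgeSet)).ncard * (n i - 1)),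
      p = ⟨i, Sum.inr ⟨u, j⟩⟩}

theorem doubleRay_adj {a b : ℤ} : doubleRay.Adj a b ↔ b = a + 1 ∨ a = b + 1 := by
  simp only [doubleRay, SimpleGraph.fromRel_adj]
  omega

theorem nZ_adj {k : ℕ} {x y : Σ _ : Fin k, ℤ} :
    (nZ k).Adj x y ↔ x.1 = y.1 ∧ (y.2 = x.2 + 1 ∨ x.2 = y.2 + 1) := by
  obtain ⟨i, a⟩ := x
  obtain ⟨j, b⟩ := y
  simp only [nZ, sigmaGraph, SimpleGraph.fromRel_adj]
  constructor
  · rintro ⟨-, ⟨h, h'⟩ | ⟨h, h'⟩⟩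
    · subst h
      exact ⟨rfl, doubleRay_adj.1 h'⟩
    · subst h
      exact ⟨rfl, (doubleRay_adj.1 h').symm⟩
  · rintro ⟨h, h'⟩
    subst h
    refine ⟨?_, Or.inl ⟨rfl, doubleRay_adj.2 h'⟩⟩
    intro h
    simp only [Sigma.mk.injEq, heq_eq_eq, true_and] at h
    omega

theorem nZ_adj_succ {k : ℕ} (i : Fin k) (m : ℤ) : (nZ k).Adj ⟨i, m⟩ ⟨i, m + 1⟩ :=
  nZ_adj.2 ⟨rfl, Or.inl rfl⟩

theorem Int.eq_of_forall_succ_eq {α : Type*} {g : ℤ → α} (h : ∀ n, g (n + 1) = g n) (n : ℤ) :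
    g n = g 0 := by
  induction n using Int.induction_on with
  | zero => rfl
  | succ n ih => rw [h, ih]
  | pred n ih => rw [← h, ← ih]; congr 1; ring

/-- An injective walk on `ℤ` with unit steps is an affine bijection. -/
theorem Int.eq_affine_of_injective {g : ℤ → ℤ} (hg : Function.Injective g)
    (h : ∀ n, g (n + 1) = g n + 1 ∨ g n = g (n + 1) + 1) :
    ∃ d : ℤ, (d = 1 ∨ d = -1) ∧ ∀ n, g n = g 0 + d * n := by
  have step : ∀ n, g (n + 1 + 1) - g (n + 1) = g (n + 1) - g n := by
    intro n
    have h1 := h n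
    have h2 := h (n + 1)
    have h3 : g (n + 1 + 1) ≠ g n := fun e => by have := hg e; omega
    omega
  have hd := Int.eq_of_forall_succ_eq (g := fun n => g (n + 1) - g n) step
  refine ⟨g 1 - g 0, by have := h 0; simp only [zero_add] at this; omega, fun n => ?_⟩
  have := Int.eq_of_forall_succ_eq (g := fun n => g n - (g 1 - g 0) * n) (fun n => by
    have := hd n
    simp only [zero_add] at this
    linear_combination this) n
  simp only [mul_zero, sub_zero] at this
  linarith

/-- A double ray in a subgraph `G` of `kℤ` covers a whole component. -/
theorem exists_component_of_ray {k : ℕ} {G : SimpleGraph (Σ _ : Fin k, ℤ)} (hG : G ≤ nZ k)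
    {f : ℤ → Σ _ : Fin k, ℤ} (hf : Function.Injective f) (h : ∀ n, G.Adj (f n) (f (n + 1))) :
    ∃ i, (∀ m, (⟨i, m⟩ : Σ _ : Fin k, ℤ) ∈ Set.range f) ∧ ∀ m, G.Adj ⟨i, m⟩ ⟨i, m + 1⟩ := by
  have hadj := fun n => nZ_adj.1 (hG (h n))
  have hfst := Int.eq_of_forall_succ_eq (g := fun n => (f n).1) fun n => (hadj n).1.symm
  have hinj : Function.Injective fun n => (f n).2 := fun a b hab =>
    hf (Sigma.ext ((hfst a).trans (hfst b).symm) (heq_of_eq hab))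
  obtain ⟨d, hd, hsnd⟩ := Int.eq_affine_of_injective hinj fun n => (hadj n).2
  have hform : ∀ n, f n = ⟨(f 0).1, (f 0).2 + d * n⟩ := fun n =>
    Sigma.ext (hfst n) (heq_of_eq (hsnd n))
  have hpre : ∀ m, f (d * (m - (f 0).2)) = ⟨(f 0).1, m⟩ := fun m => by
    rw [hform]
    congr 1
    rcases hd with rfl | rfl <;> ring
  refine ⟨(f 0).1, fun m => ⟨_, hpre m⟩, fun m => ?_⟩
  rw [← hpre m, ← hpre (m + 1)]
  rcases hd with rfl | rfl
  · convert h (1 * (m - (f 0).2)) using 2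
    ring
  · convert (h (-1 * (m + 1 - (f 0).2))).symm using 2
    ring

/-- A copy of `2ℤ` in a subgraph `G` of `kℤ` covers two whole components. -/
theorem exists_components_of_two_rays {k : ℕ} {G : SimpleGraph (Σ _ : Fin k, ℤ)} (hG : G ≤ nZ k)
    {f : (Σ _ : Fin 2, ℤ) → Σ _ : Fin k, ℤ} (hf : Function.Injective f)
    (h : ∀ ⦃x y⦄, (nZ 2).Adj x y → G.Adj (f x) (f y)) :
    ∃ i j, i ≠ j ∧ (∀ m, G.Adj ⟨i, m⟩ ⟨i, m + 1⟩) ∧ ∀ m, G.Adj ⟨j, m⟩ ⟨j, m + 1⟩ := by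
  have key : ∀ t : Fin 2, ∃ i,
      (∀ m, (⟨i, m⟩ : Σ _ : Fin k, ℤ) ∈ Set.range fun n : ℤ => f ⟨t, n⟩) ∧
        ∀ m, G.Adj ⟨i, m⟩ ⟨i, m + 1⟩ := fun t =>
    exists_component_of_ray hG (f := fun n => f ⟨t, n⟩)
      (hf.comp sigma_mk_injective) fun n => h (nZ_adj_succ t n)
  obtain ⟨i, hi, hi'⟩ := key 0
  obtain ⟨j, hj, hj'⟩ := key 1
  refine ⟨i, j, ?_, hi', hj'⟩
  rintro rfl
  obtain ⟨a, ha⟩ := hi 0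
  obtain ⟨b, hb⟩ := hj 0
  have := congrArg Sigma.fst (hf (ha.trans hb.symm))
  simp at this

/-- A monochromatic copy of `2ℤ` in a subgraph of `kℤ` covers two whole components. -/
theorem HasMonoCopy.exists_components {k : ℕ} {F : (nZ k).Subgraph} {c : Sym2 F.verts → Bool}
    {col : Bool} (h : HasMonoCopy F.coe c col (nZ 2)) :
    ∃ i j, i ≠ j ∧ ∀ t, t = i ∨ t = j → ∀ m, F.Adj ⟨t, m⟩ ⟨t, m + 1⟩ ∧
      ∃ e : Sym2 F.verts, e.map Subtype.val = s(⟨t, m⟩, ⟨t, m + 1⟩) ∧ c e = col := by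
  obtain ⟨f, hf, hadj⟩ := h
  let G : SimpleGraph (Σ _ : Fin k, ℤ) :=
    { Adj := fun x y => F.Adj x y ∧ ∃ e : Sym2 F.verts, e.map Subtype.val = s(x, y) ∧ c e = col
      symm := ⟨fun x y ⟨h, e, he, hc⟩ => ⟨h.symm, e, he.trans Sym2.eq_swap, hc⟩⟩
      loopless := ⟨fun x hx => hx.1.ne rfl⟩ }
  have hG : G ≤ nZ k := fun x y h => h.1.adj_sub
  obtain ⟨i, j, hij, hi, hj⟩ := exists_components_of_two_rays hG
    (f := fun x => (f x : Σ _ : Fin k, ℤ)) (Subtype.val_injective.comp hf)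
    fun x y hxy => ⟨(hadj hxy).1, s(f x, f y), rfl, (hadj hxy).2⟩
  refine ⟨i, j, hij, ?_⟩
  rintro t (rfl | rfl) m
  · exact hi m
  · exact hj m

theorem exists_missing_edge {k : ℕ} {F : (nZ k).Subgraph} (hF : F ≠ ⊤) :
    ∃ i m, ¬ F.Adj ⟨i, m⟩ ⟨i, m + 1⟩ := by
  by_contra! h
  refine hF (Subgraph.ext ?_ ?_)
  · exact Set.eq_univ_of_forall fun x => (h x.1 x.2).fst_mem
  · funext x y
    refine propext ⟨fun hxy => hxy.adj_sub, fun hxy => ?_⟩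
    obtain ⟨i, a⟩ := x
    obtain ⟨j, b⟩ := y
    obtain ⟨h1, h2⟩ := nZ_adj.1 hxy
    dsimp only at h1 h2
    subst h1
    rcases h2 with rfl | rfl
    · exact h i a
    · exact (h i b).symm

theorem hasMonoCopy_two_rays {k : ℕ} {c : Sym2 (Σ _ : Fin k, ℤ) → Bool} {i j : Fin k}
    {col : Bool} (hij : i ≠ j) (hi : ∀ m, c s(⟨i, m⟩, ⟨i, m + 1⟩) = col)
    (hj : ∀ m, c s(⟨j, m⟩, ⟨j, m + 1⟩) = col) : HasMonoCopy (nZ k) c col (nZ 2) := by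
  have hinj : Function.Injective ![i, j] := by
    intro a b
    fin_cases a <;> fin_cases b <;> simp [hij, hij.symm]
  have hcol : ∀ (t : Fin 2) (m : ℤ), c s(⟨![i, j] t, m⟩, ⟨![i, j] t, m + 1⟩) = col := by
    intro t m
    fin_cases t
    · exact hi m
    · exact hj m
  refine ⟨fun x => ⟨![i, j] x.1, x.2⟩, ?_, ?_⟩
  · rintro ⟨a, m⟩ ⟨b, n⟩ h
    simp only [Sigma.mk.injEq, heq_eq_eq] at h
    rw [hinj h.1, h.2]
  · rintro ⟨a, m⟩ ⟨b, n⟩ h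
    obtain ⟨h1, h2⟩ := nZ_adj.1 h
    dsimp only at h1 h2
    subst h1
    refine ⟨nZ_adj.2 ⟨rfl, h2⟩, ?_⟩
    rcases h2 with rfl | rfl
    · exact hcol a m
    · rw [Sym2.eq_swap]
      exact hcol a n

theorem twoS1_adj {x y : Fin 2 ⊕ Fin 2} (h : twoS1.Adj x y) :
    (∃ a b, a ≠ b ∧ x = Sum.inl a ∧ y = Sum.inl b) ∨
      ∃ a b, a ≠ b ∧ x = Sum.inr a ∧ y = Sum.inr b := by
  rcases x with a | a <;> rcases y with b | b <;>
    simp_all [twoS1, sumGraph, SimpleGraph.fromRel_adj]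

theorem hasMonoCopy_twoS1 {k : ℕ} {c : Sym2 (Σ _ : Fin k, ℤ) → Bool} {i j : Fin k}
    {col : Bool} (hij : i ≠ j) {m n : ℤ} (hi : c s(⟨i, m⟩, ⟨i, m + 1⟩) = col)
    (hj : c s(⟨j, n⟩, ⟨j, n + 1⟩) = col) : HasMonoCopy (nZ k) c col twoS1 := by
  have edge : ∀ (t : Fin k) (l : ℤ), c s(⟨t, l⟩, ⟨t, l + 1⟩) = col → ∀ a b : Fin 2, a ≠ b →
      (nZ k).Adj ⟨t, l + (a : ℕ)⟩ ⟨t, l + (b : ℕ)⟩ ∧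
        c s(⟨t, l + (a : ℕ)⟩, ⟨t, l + (b : ℕ)⟩) = col := by
    intro t l h a b hab
    fin_cases a <;> fin_cases b
    · exact absurd rfl hab
    · simpa using ⟨nZ_adj_succ t l, h⟩
    · rw [Sym2.eq_swap]
      simpa using ⟨(nZ_adj_succ t l).symm, h⟩
    · exact absurd rfl hab
  refine ⟨Sum.elim (fun a => ⟨i, m + (a : ℕ)⟩) fun a => ⟨j, n + (a : ℕ)⟩, ?_, ?_⟩
  · rintro (a | a) (b | b) h <;>
      simp only [Sum.elim_inl, Sum.elim_inr, Sigma.mk.injEq, heq_eq_eq] at h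
    · congr 1; omega
    · exact absurd h.1 hij
    · exact absurd h.1.symm hij
    · congr 1; omega
  · intro x y h
    obtain ⟨a, b, hab, rfl, rfl⟩ | ⟨a, b, hab, rfl, rfl⟩ := twoS1_adj h
    · exact edge i m hi a b hab
    · exact edge j n hj a b hab

theorem arrows_three_rays : Arrows (nZ 3) (nZ 2) twoS1 := by
  intro c
  let B : Fin 3 → Prop := fun i => ∃ m : ℤ, c s(⟨i, m⟩, ⟨i, m + 1⟩) = false
  have hred : ∀ i, ¬ B i → ∀ m : ℤ, c s(⟨i, m⟩, ⟨i, m + 1⟩) = true := fun i h m => by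
    simpa using not_exists.1 h m
  have hpigeon : ∃ i j, i ≠ j ∧ (B i ↔ B j) := by
    have h01 : (0 : Fin 3) ≠ 1 := by decide
    have h02 : (0 : Fin 3) ≠ 2 := by decide
    have h12 : (1 : Fin 3) ≠ 2 := by decide
    by_cases h : B 0 ↔ B 1
    · exact ⟨0, 1, h01, h⟩
    by_cases h' : B 0 ↔ B 2
    · exact ⟨0, 2, h02, h'⟩
    exact ⟨1, 2, h12, by tauto⟩
  obtain ⟨i, j, hij, h⟩ := hpigeon
  by_cases hi : B i
  · obtain ⟨m, hm⟩ := hi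
    obtain ⟨n, hn⟩ := h.1 ⟨m, hm⟩
    exact Or.inr (hasMonoCopy_twoS1 hij hm hn)
  · exact Or.inl (hasMonoCopy_two_rays hij (hred i hi) (hred j fun hj => hi (h.2 hj)))

theorem HasMonoCopy.of_embeds {α β γ : Type*} {F : SimpleGraph α} {F' : SimpleGraph β}
    {G : SimpleGraph γ} {e : α → β} (he : Function.Injective e)
    (hadj : ∀ ⦃x y⦄, F.Adj x y → F'.Adj (e x) (e y)) {c : Sym2 β → Bool} {col : Bool}
    (h : HasMonoCopy F (fun p => c (p.map e)) col G) : HasMonoCopy F' c col G := by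
  obtain ⟨f, hf, hc⟩ := h
  exact ⟨e ∘ f, he.comp hf, fun x y hxy => ⟨hadj (hc hxy).1, (hc hxy).2⟩⟩

theorem Arrows.of_embeds {α β γ δ : Type*} {F : SimpleGraph α} {F' : SimpleGraph β}
    {G : SimpleGraph γ} {H : SimpleGraph δ} (h : Arrows F G H) (hF : Embeds F F') :
    Arrows F' G H := by
  obtain ⟨e, he, hadj⟩ := hF
  exact fun c => (h fun p => c (p.map e)).imp (.of_embeds he hadj) (.of_embeds he hadj)

theorem isRamseyMinimal_three_rays : IsRamseyMinimal (nZ 3) (nZ 2) twoS1 := by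
  classical
  refine ⟨arrows_three_rays, fun F hF harr => ?_⟩
  obtain ⟨i, m, him⟩ := exists_missing_edge hF
  obtain ⟨j, hj⟩ := exists_ne i
  let b : Sym2 (Σ _ : Fin 3, ℤ) := s(⟨j, 0⟩, ⟨j, 0 + 1⟩)
  rcases harr fun e => decide (e.map Subtype.val ≠ b) with h | ⟨f, hf, h⟩
  · obtain ⟨p, q, hpq, h⟩ := h.exists_components
    have hne : ∀ t, t = p ∨ t = q → t ≠ i ∧ t ≠ j := by
      refine fun t ht => ⟨?_, ?_⟩
      · rintro rfl
        exact him (h t ht m).1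
      · rintro rfl
        obtain ⟨-, e, he, hc⟩ := h t ht 0
        exact of_decide_eq_true hc he
    have hp := hne p (.inl rfl)
    have hq := hne q (.inr rfl)
    omega
  · have h1 := (h (x := Sum.inl 0) (y := Sum.inl 1) (by
      simp [twoS1, sumGraph, SimpleGraph.fromRel_adj])).2
    have h2 := (h (x := Sum.inr 0) (y := Sum.inr 1) (by
      simp [twoS1, sumGraph, SimpleGraph.fromRel_adj])).2
    simp only [decide_eq_false_iff_not, not_not] at h1 h2
    have h3 := Sym2.map.injective Subtype.val_injective (h1.trans h2.symm)
    rcases Sym2.eq_iff.1 h3 with ⟨h4, -⟩ | ⟨h4, -⟩ <;> exact absurd (hf h4) (by simp)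

theorem not_isRamseyMinimal_four_rays : ¬ IsRamseyMinimal (nZ 4) (nZ 2) twoS1 := by
  rintro ⟨-, hmin⟩
  let F : (nZ 4).Subgraph := (⊤ : (nZ 4).Subgraph).induce {x | x.1 ≠ Fin.last 3}
  refine hmin F ?_ (arrows_three_rays.of_embeds
    ⟨fun x => ⟨⟨x.1.castSucc, x.2⟩, Fin.castSucc_ne_last x.1⟩, ?_, ?_⟩)
  · intro h
    have hmem : (⟨Fin.last 3, 0⟩ : Σ _ : Fin 4, ℤ) ∈ F.verts := by
      rw [h]
      trivial
    exact hmem rfl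
  · rintro ⟨a, m⟩ ⟨b, n⟩ h
    simpa using congrArg Subtype.val h
  · intro x y h
    obtain ⟨h1, h2⟩ := nZ_adj.1 h
    exact ⟨Fin.castSucc_ne_last x.1, Fin.castSucc_ne_last y.1,
      nZ_adj.2 ⟨congrArg Fin.castSucc h1, h2⟩⟩

theorem isRamseyMinimal_two_rays :
    IsRamseyMinimal (nZ 2) (nZ 2) (⊤ : SimpleGraph (Fin 2)) := by
  refine ⟨fun c => ?_, fun F hF harr => ?_⟩
  · by_cases h : ∃ x y, (nZ 2).Adj x y ∧ c s(x, y) = false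
    · obtain ⟨x, y, hxy, hc⟩ := h
      refine Or.inr ⟨![x, y], ?_, ?_⟩
      · intro a b
        fin_cases a <;> fin_cases b <;> simp [hxy.ne, hxy.ne.symm]
      · intro a b hab
        fin_cases a <;> fin_cases b
        · exact absurd rfl hab
        · exact ⟨hxy, hc⟩
        · exact ⟨hxy.symm, by rw [Sym2.eq_swap]; exact hc⟩
        · exact absurd rfl hab
    · push Not at h
      exact Or.inl ⟨id, Function.injective_id, fun x y hxy => ⟨hxy, by simpa using h x y hxy⟩⟩
  · obtain ⟨i, m, him⟩ := exists_missing_edge hF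
    rcases harr fun _ => true with h | ⟨f, -, h⟩
    · obtain ⟨p, q, hpq, h⟩ := h.exists_components
      exact him (h i (by omega) m).1
    · exact absurd (h (x := 0) (y := 1) (by simp)).2 (by simp)

/-- `3ℤ` is `(2ℤ, 2S₁)`-minimal; in particular `4ℤ` is not `(2ℤ, 2S₁)`-minimal, even though
`2ℤ` is `(2ℤ, S₁)`-minimal. -/
theorem stmt_13 :
    IsRamseyMinimal (nZ 3) (nZ 2) twoS1 ∧
      ¬ IsRamseyMinimal (nZ 4) (nZ 2) twoS1 ∧
      IsRamseyMinimal (nZ 2) (nZ 2) (⊤ : SimpleGraph (Fin 2)) :=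
  ⟨isRamseyMinimal_three_rays, not_isRamseyMinimal_four_rays, isRamseyMinimal_two_rays⟩
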